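/- arXiv:0906.5313 — 2 statements merged into one kernel-verified Lean document; each statement's English description precedes it below -/
import Mathlib

section
/- Let δ ∈ ℂ with δ not a nonpositive integer. Then lim_{w→1⁻} ( ₂F₁(δ, 1; 1+δ; w) + δ·ln(1−w) ) = −δ·( γ_E + ψ(δ) ), where the limit is over real w < 1; i.e., ₂F₁(δ, 1; 1+δ; w) = −δ(γ_E + ψ(δ)) − δ·ln(1−w) + o(1) as w → 1⁻. -/
open Filter

/-- Pochhammer symbol `(a)ₙ = a(a+1)⋯(a+n-1)` for complex `a`. -/
noncomputable def poch (a : ℂ) (n : ℕ) : ℂ := ∏ k ∈ Finset.range n, (a + k)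

/-- Gauss hypergeometric series `₂F₁(a,b;c;x)`. -/
noncomputable def F21 (a b c x : ℂ) : ℂ :=
  ∑' n : ℕ, poch a n * poch b n / (poch c n * n.factorial) * x ^ n

/-- `D`-dimensional Legendre (Gegenbauer) function `P(z, ν, D)`. -/
noncomputable def legP (z ν : ℂ) (D : ℕ) : ℂ :=
  Complex.Gamma (ν + D - 2) / (Complex.Gamma (ν + 1) * Complex.Gamma ((D : ℂ) - 1)) *
    F21 (-ν) (ν + (D : ℂ) - 2) (((D : ℂ) - 1) / 2) ((1 - z) / 2)

/-- Digamma function `ψ = Γ'/Γ`. -/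
noncomputable def digamma (s : ℂ) : ℂ := deriv Complex.Gamma s / Complex.Gamma s

section

open Topology Complex

/-- The factors of the Weierstrass product of `1 / Γ` differ from `1` by a quadratic error. -/
lemma norm_one_add_mul_exp_neg_sub_one_le (z : ℂ) :
    ‖(1 + z) * exp (-z) - 1‖ ≤ ((1 + ‖z‖) * Real.exp ‖z‖ + 1) * ‖z‖ ^ 2 := by
  have h := norm_exp_sub_sum_le_norm_mul_exp (-z) 2
  simp only [Finset.sum_range_succ, Finset.range_zero, Finset.sum_empty, norm_neg] at h
  norm_num at h
  have h1 : (1 + z) * exp (-z) - 1 = (1 + z) * (exp (-z) - (1 + -z)) - z ^ 2 := by ring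
  have h2 : ‖1 + z‖ ≤ 1 + ‖z‖ := by simpa using norm_add_le 1 z
  calc ‖(1 + z) * exp (-z) - 1‖
      ≤ ‖1 + z‖ * ‖exp (-z) - (1 + -z)‖ + ‖z‖ ^ 2 := by
        rw [h1, ← norm_mul, ← norm_pow]; exact norm_sub_le _ _
    _ ≤ (1 + ‖z‖) * (‖z‖ ^ 2 * Real.exp ‖z‖) + ‖z‖ ^ 2 := by gcongr
    _ = _ := by ring

lemma weierstrassProduct_hasProdLocallyUniformlyOn_ball (R : ℝ) :
    HasProdLocallyUniformlyOn (fun (n : ℕ) (s : ℂ) => (1 + s / (n + 1)) * exp (-(s / (n + 1))))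
      (fun s => ∏' n : ℕ, (1 + s / (n + 1)) * exp (-(s / (n + 1)))) (Metric.ball 0 R) := by
  have hsum : Summable fun n : ℕ =>
      ((1 + R) * Real.exp R + 1) * (R ^ 2 * (1 / ((n + 1 : ℕ) : ℝ) ^ 2)) :=
    (((summable_nat_add_iff 1).mpr
      (Real.summable_one_div_nat_pow.mpr one_lt_two)).mul_left _).mul_left _
  have := Summable.hasProdLocallyUniformlyOn_nat_one_add (K := Metric.ball (0 : ℂ) R)
    (f := fun (n : ℕ) (s : ℂ) => (1 + s / (n + 1)) * exp (-(s / (n + 1))) - 1)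
    Metric.isOpen_ball hsum ?_ (fun n => by fun_prop)
  · simpa only [add_sub_cancel] using this
  · refine Eventually.of_forall fun n s hs => (norm_one_add_mul_exp_neg_sub_one_le _).trans ?_
    have hs : ‖s‖ ≤ R := by simpa using (Metric.mem_ball.mp hs).le
    have hn : ‖(n + 1 : ℂ)‖ = n + 1 := by exact_mod_cast norm_natCast (n + 1)
    have h0 : ‖s / (n + 1)‖ ≤ ‖s‖ := by
      rw [norm_div, hn]
      exact div_le_self (norm_nonneg s) (by linarith [n.cast_nonneg (α := ℝ)])
    have h1 : ‖s / (n + 1)‖ ≤ R := h0.trans hs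
    have h2 : ‖s / (n + 1)‖ ^ 2 ≤ R ^ 2 * (1 / ((n + 1 : ℕ) : ℝ) ^ 2) := by
      rw [norm_div, hn, div_pow, mul_one_div]
      push_cast
      gcongr
    have hR : 0 ≤ R := (norm_nonneg s).trans hs
    gcongr

lemma tendsto_prod_weierstrass {s : ℂ} (hs : ∀ m : ℕ, s ≠ -m) :
    Tendsto (fun N : ℕ => ∏ n ∈ Finset.range N, (1 + s / (n + 1)) * exp (-(s / (n + 1)))) atTop
      (𝓝 (exp (-(Real.eulerMascheroniConstant * s)) * (s * Gamma s)⁻¹)) := by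
  have hs0 : s ≠ 0 := by simpa using hs 0
  have hγ : Tendsto (fun N : ℕ => exp (-(((harmonic N - Real.log N : ℝ) : ℂ) * s))) atTop
      (𝓝 (exp (-(Real.eulerMascheroniConstant * s)))) :=
    ((((continuous_ofReal.tendsto _).comp Real.tendsto_harmonic_sub_log).mul_const s).neg).cexp
  have hΓ := ((GammaSeq_tendsto_Gamma s).const_mul s).inv₀ (mul_ne_zero hs0 (Gamma_ne_zero hs))
  refine (hγ.mul hΓ).congr' ?_
  filter_upwards [eventually_ne_atTop 0] with N hN
  have hN' : (N : ℂ) ≠ 0 := by exact_mod_cast hN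
  have h1 : ∏ n ∈ Finset.range N, (1 + s / (n + 1)) =
      (∏ n ∈ Finset.range N, (s + ((n + 1 : ℕ) : ℂ))) / N.factorial := by
    rw [← Finset.prod_range_add_one_eq_factorial]
    push_cast
    rw [← Finset.prod_div_distrib]
    refine Finset.prod_congr rfl fun n _ => ?_
    have : (n + 1 : ℂ) ≠ 0 := by exact_mod_cast n.succ_ne_zero
    field_simp
    ring
  have h2 : ∏ n ∈ Finset.range N, exp (-(s / (n + 1))) = exp (-(((harmonic N : ℝ) : ℂ) * s)) := by
    rw [← exp_sum, harmonic]
    push_cast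
    rw [Finset.sum_mul, ← Finset.sum_neg_distrib]
    exact congrArg exp (Finset.sum_congr rfl fun n _ => by ring)
  have h3 : exp (-(((harmonic N - Real.log N : ℝ) : ℂ) * s)) =
      exp (-(((harmonic N : ℝ) : ℂ) * s)) * (N : ℂ) ^ s := by
    rw [cpow_def_of_ne_zero hN', ← exp_add, ← natCast_log]
    push_cast
    ring_nf
  have h4 : (N : ℂ) ^ s ≠ 0 := by simp [cpow_eq_zero_iff, hN']
  rw [Finset.prod_mul_distrib, h1, h2, h3, GammaSeq, Finset.prod_range_succ']
  have h5 : (N.factorial : ℂ) ≠ 0 := by exact_mod_cast N.factorial_ne_zero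
  have h6 : ∏ n ∈ Finset.range N, (s + ((n + 1 : ℕ) : ℂ)) ≠ 0 :=
    Finset.prod_ne_zero_iff.mpr fun n _ h => hs (n + 1) (eq_neg_of_add_eq_zero_left h)
  simp only [Nat.cast_zero, add_zero]
  field_simp

/-- The series `ψ(s) + γ = ∑ (1 / (n + 1) - 1 / (n + 1 + s)) - 1 / s` of the digamma function. -/
lemma hasSum_digamma {s : ℂ} (hs : ∀ m : ℕ, s ≠ -m) :
    HasSum (fun n : ℕ => 1 / (s + ((n + 1 : ℕ) : ℂ)) - 1 / ((n + 1 : ℕ) : ℂ))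
      (-(Real.eulerMascheroniConstant + deriv Gamma s / Gamma s) - 1 / s) := by
  have hs0 : s ≠ 0 := by simpa using hs 0
  set U : Set ℂ := Metric.ball 0 (‖s‖ + 1) ∩ {z | (Gamma z)⁻¹ ≠ 0}
  have hUo : IsOpen U := Metric.isOpen_ball.inter
    (isOpen_ne_fun differentiable_one_div_Gamma.continuous continuous_const)
  have hsU : s ∈ U := ⟨by simp, inv_ne_zero (Gamma_ne_zero hs)⟩
  have hUne {z : ℂ} (hz : z ∈ U) (m : ℕ) : z ≠ -m :=
    fun h => hz.2 (by rw [h, Gamma_neg_nat_eq_zero, inv_zero])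
  have hprod := (weierstrassProduct_hasProdLocallyUniformlyOn_ball (‖s‖ + 1)).mono
    (Set.inter_subset_left (t := {z | (Gamma z)⁻¹ ≠ 0}))
  have hlim : TendstoLocallyUniformlyOn
      (fun (I : Finset ℕ) (z : ℂ) => ∏ n ∈ I, (1 + z / (n + 1)) * exp (-(z / (n + 1))))
      (fun z => exp (-(Real.eulerMascheroniConstant * z)) * (z * Gamma z)⁻¹) atTop U :=
    TendstoLocallyUniformlyOn.congr_right hprod fun z hz =>
      tendsto_nhds_unique (hprod.hasProd hz).tendsto_prod_nat (tendsto_prod_weierstrass (hUne hz))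
  have hΓ := Gamma_ne_zero hs
  have key := logDeriv_tendsto hUo hsU hlim (.of_forall fun I => by fun_prop)
    (mul_ne_zero (exp_ne_zero _) (inv_ne_zero (mul_ne_zero hs0 hΓ)))
  have hd : HasDerivAt Gamma (deriv Gamma s) s := (differentiableAt_Gamma s hs).hasDerivAt
  have hderiv : logDeriv
      (fun z => exp (-(Real.eulerMascheroniConstant * z)) * (z * Gamma z)⁻¹) s =
      -(Real.eulerMascheroniConstant + deriv Gamma s / Gamma s) - 1 / s := by
    have h1 := (((hasDerivAt_id s).const_mul (Real.eulerMascheroniConstant : ℂ)).neg.cexp).mul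
      (((hasDerivAt_id s).mul hd).inv (mul_ne_zero hs0 hΓ))
    have h2 := h1.deriv
    simp only [Pi.mul_def, Pi.inv_def, Pi.neg_def, id] at h2
    rw [logDeriv_apply, h2]
    have := exp_ne_zero (-((Real.eulerMascheroniConstant : ℂ) * s))
    field_simp
    ring
  rw [hderiv] at key
  refine Tendsto.congr (fun I => ?_) key
  have hne (n : ℕ) : (n + 1 : ℂ) ≠ 0 := by exact_mod_cast n.succ_ne_zero
  have hsn (n : ℕ) : s + (n + 1) ≠ 0 := fun h =>
    hs (n + 1) (by push_cast; exact eq_neg_of_add_eq_zero_left h)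
  have h1n (n : ℕ) : 1 + s / (n + 1) ≠ 0 := by
    have := hsn n
    have := hne n
    rw [one_add_div this]
    exact div_ne_zero (by rwa [add_comm]) this
  have := logDeriv_prod (s := I) (x := s)
    (f := fun (n : ℕ) (z : ℂ) => (1 + z / (n + 1)) * exp (-(z / (n + 1))))
    (fun n _ => mul_ne_zero (h1n n) (exp_ne_zero _)) (fun n _ => by fun_prop)
  rw [this]
  refine Finset.sum_congr rfl fun n _ => ?_
  have hdiv := (hasDerivAt_id s).div_const (n + 1 : ℂ)
  have h2 := ((hdiv.const_add 1).mul hdiv.neg.cexp).deriv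
  simp only [Pi.mul_def, Pi.neg_def, id] at h2
  rw [logDeriv_apply, h2]
  have : (n + 1 + s : ℂ) ≠ 0 := by rw [add_comm]; exact hsn n
  have := hsn n
  have := hne n
  have := h1n n
  have := exp_ne_zero (-(s / (n + 1 : ℂ)))
  push_cast
  field_simp
  ring

lemma tendsto_sum_digamma {s : ℂ} (hs : ∀ m : ℕ, s ≠ -m) :
    Tendsto (fun N : ℕ => ∑ n ∈ Finset.range N, (1 / (s + n) - 1 / n)) atTop
      (𝓝 (-(Real.eulerMascheroniConstant + deriv Gamma s / Gamma s))) := by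
  rw [← tendsto_add_atTop_iff_nat 1]
  have h := (hasSum_digamma hs).tendsto_sum_nat.add_const (1 / s)
  rw [sub_add_cancel] at h
  refine h.congr fun N => ?_
  rw [Finset.sum_range_succ', Nat.cast_zero, add_zero, div_zero, sub_zero]

lemma poch_mul_div_eq {δ : ℂ} (hδ : ∀ m : ℕ, δ ≠ -m) (n : ℕ) :
    poch δ n * poch 1 n / (poch (1 + δ) n * n.factorial) = δ / (δ + n) := by
  have hne (m : ℕ) : δ + m ≠ 0 := fun h => hδ m (eq_neg_of_add_eq_zero_left h)
  have hfac : poch 1 n = n.factorial := by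
    rw [poch, ← Finset.prod_range_add_one_eq_factorial]
    push_cast
    exact Finset.prod_congr rfl fun k _ => add_comm _ _
  have hshift : (δ + n) * poch δ n = δ * poch (1 + δ) n := by
    have h1 := Finset.prod_range_succ (fun k : ℕ => δ + k) n
    rw [Finset.prod_range_succ'] at h1
    have h2 : ∏ k ∈ Finset.range n, (δ + ((k + 1 : ℕ) : ℂ)) = poch (1 + δ) n :=
      Finset.prod_congr rfl fun k _ => by push_cast; ring
    rw [h2, Nat.cast_zero, add_zero] at h1
    rw [poch, mul_comm, ← h1, mul_comm]
  have hp : poch (1 + δ) n ≠ 0 := Finset.prod_ne_zero_iff.mpr fun k _ h =>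
    hne (k + 1) (by push_cast; linear_combination h)
  have hf : (n.factorial : ℂ) ≠ 0 := by exact_mod_cast n.factorial_ne_zero
  rw [hfac, mul_div_mul_right _ _ hf, div_eq_div_iff hp (hne n), mul_comm, hshift]

lemma F21_add_log_eq_tsum {δ : ℂ} (hδ : ∀ m : ℕ, δ ≠ -m) {w : ℝ} (h0 : 0 < w) (h1 : w < 1) :
    F21 δ 1 (1 + δ) w + δ * Real.log (1 - w) =
      ∑' n : ℕ, δ * (1 / (δ + n) - 1 / n) * (w : ℂ) ^ n := by
  have hw : ‖(w : ℂ)‖ < 1 := by rwa [norm_real, Real.norm_of_nonneg h0.le]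
  have hlog := (hasSum_taylorSeries_neg_log hw).mul_left δ
  have hb : Tendsto (fun n : ℕ => δ * (1 / (δ + n) - 1 / n)) atTop (𝓝 0) := by
    have hs : Summable fun n : ℕ => 1 / (δ + n) - 1 / (n : ℂ) :=
      (summable_nat_add_iff 1).mp (hasSum_digamma hδ).summable
    rw [← mul_zero δ]
    exact hs.tendsto_atTop_zero.const_mul δ
  have hsum : Summable fun n : ℕ => δ * (1 / (δ + n) - 1 / n) * (w : ℂ) ^ n := by
    refine summable_of_isBigO_nat (g := fun n => ‖(w : ℂ)‖ ^ n)
      (summable_geometric_of_lt_one (norm_nonneg _) hw) ?_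
    simpa using (hb.isBigO_one ℝ).mul
      (Asymptotics.isBigO_refl (fun n : ℕ => (w : ℂ) ^ n) atTop).norm_right
  have hF : F21 δ 1 (1 + δ) w =
      ∑' n : ℕ, (δ * (1 / (δ + n) - 1 / n) * (w : ℂ) ^ n + δ * ((w : ℂ) ^ n / n)) := by
    rw [F21]
    refine tsum_congr fun n => ?_
    rw [poch_mul_div_eq hδ]
    ring
  rw [hF, hsum.tsum_add hlog.summable, hlog.tsum_eq, ofReal_log (by linarith)]
  push_cast
  ring

end

/-- For `δ` not a nonpositive integer,
`₂F₁(δ,1;1+δ;w) + δ·ln(1-w) → -δ(γ_E + ψ(δ))` as `w → 1⁻` (over real `w < 1`). -/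
theorem stmt10 (δ : ℂ) (hδ : ∀ m : ℕ, δ ≠ -(m : ℂ)) :
    Tendsto (fun w : ℝ => F21 δ 1 (1 + δ) (w : ℂ) + δ * (Real.log (1 - w) : ℂ))
      (nhdsWithin 1 (Set.Iio 1))
      (nhds (-δ * ((Real.eulerMascheroniConstant : ℂ) + digamma δ))) := by
  have hsum := (tendsto_sum_digamma hδ).const_mul δ
  simp only [Finset.mul_sum] at hsum
  have habel := tendsto_map'_iff.mp (Complex.tendsto_tsum_powerSeries_nhdsWithin_lt hsum)
  rw [mul_neg, ← neg_mul] at habel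
  refine habel.congr' ?_
  filter_upwards [Ioo_mem_nhdsLT zero_lt_one] with w hw
  exact (F21_add_log_eq_tsum hδ hw.1 hw.2).symm
end

section
/- Let D ≥ 3 be an integer, let z ∈ [−1,1] be real, and let h be real with |h| < 1. Then the series Σ_{l=0}^∞ P(z,l,D)·h^l converges absolutely and (1/(D−2)) · (1 − 2hz + h²)^{−(D−2)/2} = Σ_{l=0}^∞ P(z,l,D)·h^l; note that 1 − 2hz + h² ≥ (1−|h|)² > 0. -/
open Filter

theorem poch_zero (a : ℂ) : poch a 0 = 1 := by simp [poch]

theorem poch_succ (a : ℂ) (n : ℕ) : poch a (n + 1) = poch a n * (a + n) := by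
  simp [poch, Finset.prod_range_succ]

theorem poch_succ_left (a : ℂ) (n : ℕ) : poch a (n + 1) = a * poch (a + 1) n := by
  simp only [poch, Finset.prod_range_succ', Nat.cast_add, Nat.cast_one, Nat.cast_zero, add_zero]
  rw [mul_comm]
  congr 1
  exact Finset.prod_congr rfl fun k _ => by ring

theorem poch_add (a : ℂ) (m n : ℕ) : poch a (m + n) = poch a m * poch (a + m) n := by
  simp [poch, Finset.prod_range_add, add_assoc]

theorem poch_neg_natCast_eq_zero {l n : ℕ} (h : l < n) : poch (-(l : ℂ)) n = 0 :=
  Finset.prod_eq_zero (Finset.mem_range.2 h) (neg_add_cancel _)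

theorem poch_ne_zero {a : ℂ} (ha : ∀ k : ℕ, a + k ≠ 0) (n : ℕ) : poch a n ≠ 0 :=
  Finset.prod_ne_zero_iff.2 fun k _ => ha k

/-- Coefficient of `((1 - z) / 2) ^ n` in the Gegenbauer polynomial of degree `l` and
parameter `s`. -/
noncomputable def gegenbauerCoeff (s : ℂ) (l n : ℕ) : ℂ :=
  poch (2 * s) (l + n) * poch (-(l : ℂ)) n / (l.factorial * (poch (s + 1 / 2) n * n.factorial))

/-- Gegenbauer polynomial of degree `l` and parameter `s`, as a function of `x = (1 - z) / 2`. -/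
noncomputable def gegenbauer (s x : ℂ) (l : ℕ) : ℂ :=
  ∑ n ∈ Finset.range (l + 1), gegenbauerCoeff s l n * x ^ n

theorem gegenbauerCoeff_eq_zero (s : ℂ) {l n : ℕ} (h : l < n) : gegenbauerCoeff s l n = 0 := by
  simp [gegenbauerCoeff, poch_neg_natCast_eq_zero h]

theorem gegenbauer_eq_sum_range (s x : ℂ) {l N : ℕ} (h : l < N) :
    gegenbauer s x l = ∑ n ∈ Finset.range N, gegenbauerCoeff s l n * x ^ n := by
  refine Finset.sum_subset (Finset.range_subset_range.2 h) fun n _ hn => ?_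
  rw [gegenbauerCoeff_eq_zero s (by simpa using hn), zero_mul]

theorem gegenbauer_eq_F21 (s x : ℂ) (l : ℕ) :
    gegenbauer s x l =
      poch (2 * s) l / l.factorial * F21 (-(l : ℂ)) (l + 2 * s) (s + 1 / 2) x := by
  rw [F21, tsum_eq_sum (s := Finset.range (l + 1)), gegenbauer, Finset.mul_sum]
  · refine Finset.sum_congr rfl fun n _ => ?_
    rw [gegenbauerCoeff, poch_add, add_comm (l : ℂ)]
    simp only [div_eq_mul_inv, mul_inv]
    ring
  · intro n hn
    rw [poch_neg_natCast_eq_zero (by simpa using hn)]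
    simp

theorem gegenbauerCoeff_zero_recurrence (s : ℂ) (l : ℕ) :
    (l + 2) * gegenbauerCoeff s (l + 2) 0 =
      2 * (l + 1 + s) * gegenbauerCoeff s (l + 1) 0 - (l + 2 * s) * gegenbauerCoeff s l 0 := by
  have h1 : (l : ℂ) + 1 ≠ 0 := Nat.cast_add_one_ne_zero l
  have h2 : (l : ℂ) + 1 + 1 ≠ 0 := by exact_mod_cast (l + 1).succ_ne_zero
  have h3 : (l.factorial : ℂ) ≠ 0 := by exact_mod_cast l.factorial_ne_zero
  simp only [gegenbauerCoeff, add_zero, poch_zero, poch_succ, Nat.factorial_succ, Nat.factorial_zero]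
  push_cast
  field_simp
  ring

theorem gegenbauerCoeff_succ_recurrence {s : ℂ} (hs : ∀ k : ℕ, s + 1 / 2 + k ≠ 0) (l n : ℕ) :
    (l + 2) * gegenbauerCoeff s (l + 2) (n + 1) =
      2 * (l + 1 + s) * (gegenbauerCoeff s (l + 1) (n + 1) - 2 * gegenbauerCoeff s (l + 1) n) -
        (l + 2 * s) * gegenbauerCoeff s l (n + 1) := by
  have h1 : (l : ℂ) + 1 ≠ 0 := Nat.cast_add_one_ne_zero l
  have h2 : (l : ℂ) + 1 + 1 ≠ 0 := by exact_mod_cast (l + 1).succ_ne_zero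
  have h3 : (l.factorial : ℂ) ≠ 0 := by exact_mod_cast l.factorial_ne_zero
  have h4 : (n.factorial : ℂ) ≠ 0 := by exact_mod_cast n.factorial_ne_zero
  have h5 : (n : ℂ) + 1 ≠ 0 := Nat.cast_add_one_ne_zero n
  have h6 := poch_ne_zero hs n
  have h7 := hs n
  have e1 : poch (-((l + 2 : ℕ) : ℂ)) (n + 1) = -(l + 2) * poch (-((l + 1 : ℕ) : ℂ)) n := by
    rw [poch_succ_left]
    push_cast
    ring_nf
  have e2 : poch (-((l + 1 : ℕ) : ℂ)) (n + 1) = poch (-((l + 1 : ℕ) : ℂ)) n * (n - l - 1) := by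
    rw [poch_succ]
    push_cast
    ring
  have e3 : poch (-(l : ℂ)) (n + 1) =
      poch (-((l + 1 : ℕ) : ℂ)) n * (n - l - 1) * (l - n) / (l + 1) := by
    have h := (poch_succ_left (-((l + 1 : ℕ) : ℂ)) (n + 1)).symm.trans (poch_succ _ _)
    rw [e2] at h
    push_cast at h ⊢
    rw [show -((l : ℂ) + 1) + 1 = -l by ring] at h
    rw [eq_div_iff h1]
    linear_combination -h
  simp only [gegenbauerCoeff, e1, e2, e3, Nat.factorial_succ, poch_succ (s + 1 / 2),
    show l + 2 + (n + 1) = l + n + 1 + 1 + 1 by ring, show l + 1 + (n + 1) = l + n + 1 + 1 by ring,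
    show l + 1 + n = l + n + 1 by ring, show l + (n + 1) = l + n + 1 by ring, poch_succ (2 * s)]
  generalize poch (2 * s) (l + n) = S
  generalize poch (-((l + 1 : ℕ) : ℂ)) n = R
  generalize poch (s + 1 / 2) n = T at *
  push_cast
  obtain ⟨c, rfl⟩ : ∃ c, s = c - 1 / 2 := ⟨s + 1 / 2, by ring⟩
  rw [sub_add_cancel] at *
  field_simp
  ring

theorem gegenbauer_zero (s x : ℂ) : gegenbauer s x 0 = 1 := by
  simp [gegenbauer, gegenbauerCoeff, poch_zero]

theorem gegenbauer_one {s : ℂ} (hs : ∀ k : ℕ, s + 1 / 2 + k ≠ 0) (x : ℂ) :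
    gegenbauer s x 1 = 2 * s * (1 - 2 * x) := by
  obtain ⟨c, rfl⟩ : ∃ c, s = c - 1 / 2 := ⟨s + 1 / 2, by ring⟩
  have h : c ≠ 0 := by simpa using hs 0
  simp only [gegenbauer, gegenbauerCoeff, Finset.sum_range_succ, Finset.sum_range_zero, poch_zero,
    poch_succ, Nat.factorial, sub_add_cancel]
  push_cast
  rw [add_zero c]
  field_simp
  ring

theorem gegenbauer_recurrence {s : ℂ} (hs : ∀ k : ℕ, s + 1 / 2 + k ≠ 0) (x : ℂ) (l : ℕ) :
    (l + 2) * gegenbauer s x (l + 2) =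
      2 * (l + 1 + s) * (1 - 2 * x) * gegenbauer s x (l + 1) -
        (l + 2 * s) * gegenbauer s x l := by
  have key : 2 * (l + 1 + s) * (1 - 2 * x) * gegenbauer s x (l + 1) =
      2 * (l + 1 + s) * gegenbauer s x (l + 1) -
        4 * (l + 1 + s) * (x * gegenbauer s x (l + 1)) := by ring
  have hx : x * gegenbauer s x (l + 1) =
      ∑ n ∈ Finset.range (l + 2), gegenbauerCoeff s (l + 1) n * x ^ (n + 1) := by
    rw [gegenbauer, Finset.mul_sum]
    exact Finset.sum_congr rfl fun n _ => by ring
  rw [key, hx, gegenbauer_eq_sum_range s x (show l + 2 < l + 3 by lia),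
    gegenbauer_eq_sum_range s x (show l + 1 < l + 3 by lia),
    gegenbauer_eq_sum_range s x (show l < l + 3 by lia)]
  simp only [Finset.sum_range_succ' _ (l + 2), pow_zero, mul_one]
  have hsum : (l + 2) * ∑ n ∈ Finset.range (l + 2),
        gegenbauerCoeff s (l + 2) (n + 1) * x ^ (n + 1) =
      2 * (l + 1 + s) * ∑ n ∈ Finset.range (l + 2),
          gegenbauerCoeff s (l + 1) (n + 1) * x ^ (n + 1) -
        4 * (l + 1 + s) * ∑ n ∈ Finset.range (l + 2),
          gegenbauerCoeff s (l + 1) n * x ^ (n + 1) -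
        (l + 2 * s) * ∑ n ∈ Finset.range (l + 2),
          gegenbauerCoeff s l (n + 1) * x ^ (n + 1) := by
    simp only [Finset.mul_sum]
    rw [← Finset.sum_sub_distrib, ← Finset.sum_sub_distrib]
    refine Finset.sum_congr rfl fun n _ => ?_
    linear_combination x ^ (n + 1) * gegenbauerCoeff_succ_recurrence hs l n
  linear_combination hsum + gegenbauerCoeff_zero_recurrence s l

/-- Taylor coefficients of `t ↦ (1 - t) ^ (-s)`. -/
noncomputable def negBinom (s : ℂ) (n : ℕ) : ℂ := Ring.choose (s + n - 1) n

theorem negBinom_eq (s : ℂ) (n : ℕ) :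
    negBinom s n = (ascPochhammer ℂ n).eval s / n.factorial := by
  have h3 : (n.factorial : ℂ) ≠ 0 := by exact_mod_cast n.factorial_ne_zero
  rw [negBinom, ← Ring.multichoose_eq, eq_div_iff h3, ← Polynomial.ascPochhammer_smeval_eq_eval,
    ← Ring.factorial_nsmul_multichoose_eq_ascPochhammer, nsmul_eq_mul, mul_comm]

theorem negBinom_zero (s : ℂ) : negBinom s 0 = 1 := by simp [negBinom_eq]

theorem negBinom_succ (s : ℂ) (n : ℕ) :
    (n + 1) * negBinom s (n + 1) = (s + n) * negBinom s n := by
  have h3 : (n.factorial : ℂ) ≠ 0 := by exact_mod_cast n.factorial_ne_zero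
  have h5 : (n : ℂ) + 1 ≠ 0 := Nat.cast_add_one_ne_zero n
  rw [negBinom_eq, negBinom_eq, ascPochhammer_succ_eval, Nat.factorial_succ]
  push_cast
  field_simp

/-- The power series of `t ↦ (1 - a t) ^ (-s)`. -/
noncomputable def negBinomSeries (s a : ℂ) : PowerSeries ℂ :=
  PowerSeries.mk fun n => negBinom s n * a ^ n

theorem derivative_negBinomSeries (s a : ℂ) :
    (1 - PowerSeries.C a * PowerSeries.X) * PowerSeries.derivative ℂ (negBinomSeries s a) =
      PowerSeries.C (s * a) * negBinomSeries s a := by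
  ext n
  rw [sub_mul, one_mul, mul_assoc, map_sub, PowerSeries.coeff_C_mul, PowerSeries.coeff_C_mul]
  cases n with
  | zero =>
    have h := negBinom_succ s 0
    simp [PowerSeries.coeff_derivative, negBinomSeries] at h ⊢
    linear_combination a * h
  | succ n =>
    have h := negBinom_succ s (n + 1)
    rw [PowerSeries.coeff_succ_X_mul]
    simp only [PowerSeries.coeff_derivative, negBinomSeries, PowerSeries.coeff_mk]
    push_cast at h ⊢
    linear_combination a ^ (n + 2) * h

theorem coeff_negBinomSeries_mul_recurrence (s : ℂ) {a b : ℂ} (hab : a * b = 1) (l : ℕ) :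
    (l + 2) * PowerSeries.coeff (l + 2) (negBinomSeries s a * negBinomSeries s b) =
      (l + 1 + s) * (a + b) * PowerSeries.coeff (l + 1) (negBinomSeries s a * negBinomSeries s b) -
        (l + 2 * s) * PowerSeries.coeff l (negBinomSeries s a * negBinomSeries s b) := by
  have hA := derivative_negBinomSeries s a
  have hB := derivative_negBinomSeries s b
  have hC : PowerSeries.C a * PowerSeries.C b = (1 : PowerSeries ℂ) := by
    rw [← map_mul, hab, map_one]
  have hF : PowerSeries.derivative ℂ (negBinomSeries s a * negBinomSeries s b) -
        PowerSeries.C (a + b) * (PowerSeries.X *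
          PowerSeries.derivative ℂ (negBinomSeries s a * negBinomSeries s b)) +
        PowerSeries.X * (PowerSeries.X *
          PowerSeries.derivative ℂ (negBinomSeries s a * negBinomSeries s b)) =
      PowerSeries.C (s * (a + b)) * (negBinomSeries s a * negBinomSeries s b) -
        PowerSeries.C (2 * s) * (PowerSeries.X * (negBinomSeries s a * negBinomSeries s b)) := by
    rw [Derivation.leibniz]
    simp only [smul_eq_mul, map_mul, map_add, map_ofNat] at hA hB ⊢
    generalize PowerSeries.derivative ℂ (negBinomSeries s a) = dA at *
    generalize PowerSeries.derivative ℂ (negBinomSeries s b) = dB at *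
    generalize negBinomSeries s a = A at *
    generalize negBinomSeries s b = B at *
    generalize PowerSeries.C a = α at *
    generalize PowerSeries.C b = β at *
    generalize PowerSeries.C s = σ at *
    generalize (PowerSeries.X : PowerSeries ℂ) = X at *
    linear_combination (1 - β * X) * B * hA + (1 - α * X) * A * hB -
      (X ^ 2 * (A * dB + B * dA) + 2 * σ * X * A * B) * hC
  clear hA hB hC
  generalize a + b = e at *
  have h := congrArg (PowerSeries.coeff (l + 1)) hF
  generalize negBinomSeries s a * negBinomSeries s b = F at *
  simp only [map_sub, map_add, PowerSeries.coeff_C_mul, PowerSeries.coeff_succ_X_mul,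
    PowerSeries.coeff_derivative] at h
  cases l with
  | zero =>
    simp at h ⊢
    linear_combination h
  | succ l =>
    rw [PowerSeries.coeff_succ_X_mul, PowerSeries.coeff_derivative] at h
    push_cast at h ⊢
    linear_combination h

theorem coeff_negBinomSeries_mul_eq_gegenbauer {s : ℂ} (hs : ∀ k : ℕ, s + 1 / 2 + k ≠ 0)
    {a b x : ℂ} (hab : a * b = 1) (hx : a + b = 2 * (1 - 2 * x)) (l : ℕ) :
    PowerSeries.coeff l (negBinomSeries s a * negBinomSeries s b) = gegenbauer s x l := by
  induction l using Nat.twoStepInduction with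
  | zero => simp [PowerSeries.coeff_mul, negBinomSeries, negBinom_zero, gegenbauer_zero]
  | one =>
    have h := negBinom_succ s 0
    have h1 : negBinom s 1 = s := by simpa [negBinom_zero] using h
    simp only [PowerSeries.coeff_mul, negBinomSeries, PowerSeries.coeff_mk, gegenbauer_one hs,
      Finset.Nat.antidiagonal_succ, Finset.Nat.antidiagonal_zero]
    simp [negBinom_zero, h1]
    linear_combination s * hx
  | more l ih0 ih1 =>
    have h2 : (l : ℂ) + 2 ≠ 0 := by exact_mod_cast (l + 1).succ_ne_zero
    refine mul_left_cancel₀ h2 ?_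
    rw [coeff_negBinomSeries_mul_recurrence s hab, gegenbauer_recurrence hs, ih0, ih1, hx]
    ring

theorem summable_norm_negBinom (s : ℂ) {w : ℂ} (hw : ‖w‖ < 1) :
    Summable fun n => ‖negBinom s n * w ^ n‖ := by
  have H := Complex.one_div_one_sub_cpow_hasFPowerSeriesOnBall_zero s
  have hm : w ∈ Metric.eball (0 : ℂ) 1 := by
    simpa [← ofReal_norm, ENNReal.ofReal_lt_one] using hw
  simpa [FormalMultilinearSeries.ofScalars_apply_eq, negBinom, mul_comm] using
    FormalMultilinearSeries.summable_norm_apply _ (Metric.eball_subset_eball H.r_le hm)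

theorem tsum_negBinom (s : ℂ) {w : ℂ} (hw : ‖w‖ < 1) :
    ∑' n, negBinom s n * w ^ n = 1 / (1 - w) ^ s := by
  have H := Complex.one_div_one_sub_cpow_hasFPowerSeriesOnBall_zero s
  have hm : w ∈ Metric.eball (0 : ℂ) 1 := by
    simpa [← ofReal_norm, ENNReal.ofReal_lt_one] using hw
  simpa [FormalMultilinearSeries.ofScalars_apply_eq, negBinom, mul_comm] using (H.hasSum hm).tsum_eq

theorem coeff_negBinomSeries_mul_mul_pow (s a b t : ℂ) (l : ℕ) :
    PowerSeries.coeff l (negBinomSeries s a * negBinomSeries s b) * t ^ l =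
      ∑ p ∈ Finset.HasAntidiagonal.antidiagonal l,
        negBinom s p.1 * (a * t) ^ p.1 * (negBinom s p.2 * (b * t) ^ p.2) := by
  rw [PowerSeries.coeff_mul, Finset.sum_mul]
  refine Finset.sum_congr rfl fun p hp => ?_
  rw [← Finset.HasAntidiagonal.mem_antidiagonal.1 hp]
  simp only [negBinomSeries, PowerSeries.coeff_mk]
  ring

theorem mul_conj_cpow {w : ℂ} (hw : 0 < w.re) (s : ℂ) :
    (w * (starRingEnd ℂ) w) ^ s = w ^ s * (starRingEnd ℂ) w ^ s := by
  have harg : w.arg ≠ Real.pi := by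
    have := Complex.abs_arg_lt_pi_div_two_iff.2 (Or.inl hw)
    have h2 := (abs_lt.1 this).2
    have := Real.pi_pos
    intro h
    linarith
  have h0 : w ≠ 0 := fun h => by simp [h] at hw
  have h0' : (starRingEnd ℂ) w ≠ 0 := by simpa using h0
  rw [Complex.cpow_def_of_ne_zero (mul_ne_zero h0 h0'), Complex.cpow_def_of_ne_zero h0,
    Complex.cpow_def_of_ne_zero h0', Complex.log_mul h0 h0', add_mul, Complex.exp_add]
  simp [Complex.arg_conj, harg, Real.pi_pos, Real.pi_pos.le]

theorem legP_natCast {D : ℕ} (hD : 3 ≤ D) (z : ℂ) (l : ℕ) :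
    legP z l D = 1 / ((D : ℂ) - 2) * gegenbauer (((D : ℂ) - 2) / 2) ((1 - z) / 2) l := by
  obtain ⟨m, rfl⟩ := Nat.exists_eq_add_of_le' hD
  have h1 : (m : ℂ) + 1 ≠ 0 := Nat.cast_add_one_ne_zero m
  have h3 : (l.factorial : ℂ) ≠ 0 := by exact_mod_cast l.factorial_ne_zero
  have h4 : (m.factorial : ℂ) ≠ 0 := by exact_mod_cast m.factorial_ne_zero
  have hp : ((m + l).factorial : ℂ) = m.factorial * poch (m + 1) l := by
    induction l with
    | zero => simp [poch_zero]
    | succ l ih =>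
      rw [← add_assoc, Nat.factorial_succ, poch_succ]
      push_cast
      rw [ih (by exact_mod_cast l.factorial_ne_zero)]
      ring
  rw [gegenbauer_eq_F21, legP]
  push_cast
  rw [show (l : ℂ) + (m + 3) - 2 = ((m + l : ℕ) : ℂ) + 1 by push_cast; ring,
    show (m : ℂ) + 3 - 1 = ((m + 1 : ℕ) : ℂ) + 1 by push_cast; ring,
    Complex.Gamma_nat_eq_factorial, Complex.Gamma_nat_eq_factorial, Complex.Gamma_nat_eq_factorial,
    hp, Nat.factorial_succ,
    show 2 * (((m : ℂ) + 3 - 2) / 2) = m + 1 by ring,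
    show ((m : ℂ) + 3 - 2) / 2 + 1 / 2 = (((m + 1 : ℕ) : ℂ) + 1) / 2 by push_cast; ring,
    show (l : ℂ) + (m + 1) = ((m + l : ℕ) : ℂ) + 1 by push_cast; ring,
    show (m : ℂ) + 3 - 2 = m + 1 by ring]
  push_cast
  field_simp

/-- Generating function of the `D`-dimensional Legendre polynomials, `D ≥ 3`:
for `z ∈ [-1,1]` and `|h| < 1`,
`(1/(D-2))·(1-2hz+h²)^{-(D-2)/2} = Σ_l P(z,l,D) h^l`, absolutely convergent. -/
theorem stmt15 (D : ℕ) (hD : 3 ≤ D) (z h : ℝ) (hz : z ∈ Set.Icc (-1 : ℝ) 1) (hh : |h| < 1) :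
    Summable (fun l : ℕ => ‖legP (z : ℂ) (l : ℂ) D * (h : ℂ) ^ l‖) ∧
    ((1 / ((D : ℝ) - 2) * (1 - 2 * h * z + h ^ 2) ^ (-(((D : ℝ) - 2) / 2)) : ℝ) : ℂ) =
      ∑' l : ℕ, legP (z : ℂ) (l : ℂ) D * (h : ℂ) ^ l := by
  have hw : 0 ≤ 1 - z ^ 2 := by nlinarith [hz.1, hz.2]
  set r := Real.sqrt (1 - z ^ 2)
  have hr : r ^ 2 = 1 - z ^ 2 := Real.sq_sqrt hw
  set a : ℂ := ⟨z, r⟩ with ha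
  set b : ℂ := (starRingEnd ℂ) a with hb
  set s : ℂ := ((D : ℂ) - 2) / 2 with hs_def
  have hDr : (3 : ℝ) ≤ D := by exact_mod_cast hD
  have hab : a * b = 1 := by
    apply Complex.ext <;> simp [ha, hb] <;> nlinarith
  have hsum : a + b = 2 * (1 - 2 * ((1 - (z : ℂ)) / 2)) := by
    apply Complex.ext <;> simp [ha, hb]
    ring
  have hna : ‖a‖ = 1 := by
    rw [← sq_eq_sq₀ (norm_nonneg _) zero_le_one, ← Complex.normSq_eq_norm_sq, Complex.normSq_apply]
    simp only [ha]
    nlinarith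
  have hnb : ‖b‖ = 1 := by rw [hb, RCLike.norm_conj, hna]
  have hat : ‖a * h‖ < 1 := by simpa [hna] using hh
  have hbt : ‖b * h‖ < 1 := by simpa [hnb] using hh
  have hs : ∀ k : ℕ, s + 1 / 2 + k ≠ 0 := fun k hk => by
    have h' := congrArg Complex.re hk
    simp [hs_def] at h'
    have : (0 : ℝ) ≤ k := k.cast_nonneg
    linarith
  have hterm : ∀ l : ℕ, legP (z : ℂ) (l : ℂ) D * (h : ℂ) ^ l = 1 / ((D : ℂ) - 2) *
      ∑ p ∈ Finset.HasAntidiagonal.antidiagonal l,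
        negBinom s p.1 * (a * h) ^ p.1 * (negBinom s p.2 * (b * h) ^ p.2) := fun l => by
    rw [legP_natCast hD, ← coeff_negBinomSeries_mul_eq_gegenbauer hs hab hsum, mul_assoc,
      coeff_negBinomSeries_mul_mul_pow]
  have hsa := summable_norm_negBinom s hat
  have hsb := summable_norm_negBinom s hbt
  rw [show (fun l : ℕ => ‖legP (z : ℂ) (l : ℂ) D * (h : ℂ) ^ l‖) = _ from
    funext fun l => congrArg norm (hterm l), tsum_congr hterm]
  constructor
  · simp only [norm_mul (1 / ((D : ℂ) - 2))]
    exact (summable_norm_sum_mul_antidiagonal_of_summable_norm hsa hsb).mul_left _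
  · rw [tsum_mul_left, ← tsum_mul_tsum_eq_tsum_sum_antidiagonal_of_summable_norm hsa hsb,
      tsum_negBinom s hat, tsum_negBinom s hbt]
    have hre : 0 < (1 - a * h).re := by
      have := (Complex.re_le_norm (a * h)).trans_lt hat
      simpa using this
    have hconj : 1 - b * h = (starRingEnd ℂ) (1 - a * h) := by simp [hb]
    have hprod : (1 - a * h) * (1 - b * h) = ((1 - 2 * h * z + h ^ 2 : ℝ) : ℂ) := by
      push_cast
      linear_combination h ^ 2 * hab - h * hsum
    have hpos : 0 ≤ 1 - 2 * h * z + h ^ 2 := by nlinarith [sq_nonneg (h - z)]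
    rw [one_div_mul_one_div, hconj, ← mul_conj_cpow hre, ← hconj, hprod, Complex.ofReal_mul,
      Complex.ofReal_cpow hpos]
    push_cast
    rw [Complex.cpow_neg, hs_def, one_div (_ ^ _)]
end
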